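/- arXiv:math/0504256 — 3 statements merged into one kernel-verified Lean document; each statement's English description precedes it below -/
import Mathlib

section
/- Let A be a noetherian ring, I an ideal of A, and let Â denote the I-adic completion of A. Then dim Â = sup over prime ideals p containing I of dim A_p; in particular dim Â ≤ dim A. -/
lemma exists_sub_mem_map (A : Type*) [CommRing A] [IsNoetherianRing A] (I : Ideal A)
    (y : AdicCompletion I A) :
    ∃ a : A, y - algebraMap A (AdicCompletion I A) a ∈
      I.map (algebraMap A (AdicCompletion I A)) := by
  obtain ⟨a, ha⟩ := Ideal.Quotient.mk_surjective (AdicCompletion.evalOneₐ I y)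
  refine ⟨a, ?_⟩
  rw [← AdicCompletion.ker_evalOneₐ_eq_map I I.fg_of_isNoetherianRing, RingHom.mem_ker, map_sub,
    sub_eq_zero]
  have h := RingHom.congr_fun (AdicCompletion.evalOneₐ_comp_algebraMap_eq_mk I) a
  exact ha.symm.trans h.symm

lemma isNoetherianRing_adicCompletion (A : Type*) [CommRing A] [IsNoetherianRing A]
    (I : Ideal A) : IsNoetherianRing (AdicCompletion I A) := by
  classical
  obtain ⟨n, a, ha⟩ := Submodule.fg_iff_exists_fin_generating_family.mp I.fg_of_isNoetherianRing
  let P := MvPolynomial (Fin n) A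
  let J : Ideal P := MvPolynomial.idealOfVars (Fin n) A
  let φ : P →+* A := (MvPolynomial.aeval a : P →ₐ[A] A).toRingHom
  have hJ : J.map φ = I := by
    rw [← ha]
    simp only [J, φ, MvPolynomial.idealOfVars, Ideal.map_span, ← Set.range_comp]
    congr 2
    ext i
    exact MvPolynomial.aeval_X a i
  have hJn (k : ℕ) : J ^ k ≤ (I ^ k).comap φ := by
    rw [← Ideal.map_le_iff_le_comap, Ideal.map_pow, hJ]
  let f (k : ℕ) : AdicCompletion J P →+* A ⧸ I ^ k :=
    (Ideal.quotientMap (I ^ k) φ (hJn k)).comp (AdicCompletion.evalₐ J k).toRingHom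
  have hf : ∀ {k l : ℕ} (hle : k ≤ l), (Ideal.Quotient.factorPow I hle).comp (f l) = f k := by
    intro k l hle
    ext x
    obtain ⟨x, rfl⟩ := AdicCompletion.mk_surjective J P x
    simp only [f, RingHom.comp_apply, AlgHom.toRingHom_eq_coe, RingHom.coe_coe,
      AdicCompletion.evalₐ_mk, Ideal.quotientMap_mk]
    have h := AdicCompletion.Ideal.mk_eq_mk J hle x
    have h2 := congrArg (Ideal.quotientMap (I ^ k) φ (hJn k)) h
    rw [Ideal.quotientMap_mk, Ideal.quotientMap_mk] at h2
    exact h2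
  let Φ := AdicCompletion.liftRingHom I f hf
  have hΦ (p : P) : Φ (algebraMap P (AdicCompletion J P) p) =
      algebraMap A (AdicCompletion I A) (φ p) := by
    apply AdicCompletion.ext_evalₐ
    intro k
    rw [AdicCompletion.evalₐ_liftRingHom]
    simp [f]
  have hΦc : Φ.comp (algebraMap P (AdicCompletion J P)) =
      (algebraMap A (AdicCompletion I A)).comp φ := RingHom.ext hΦ
  have hmap : (J.map (algebraMap P (AdicCompletion J P))).map Φ =
      I.map (algebraMap A (AdicCompletion I A)) := by
    rw [Ideal.map_map, hΦc, ← Ideal.map_map, hJ]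
  have := AdicCompletion.isAdicComplete_self J J.fg_of_isNoetherianRing
  have hc := AdicCompletion.isAdicComplete_self I I.fg_of_isNoetherianRing
  have : IsHausdorff ((J.map (algebraMap P (AdicCompletion J P))).map Φ) (AdicCompletion I A) := by
    rw [hmap]; infer_instance
  have hs : Function.Surjective Φ := by
    apply surjective_of_mk_map_comp_surjective Φ
      (I := J.map (algebraMap P (AdicCompletion J P)))
    intro y
    obtain ⟨y, rfl⟩ := Ideal.Quotient.mk_surjective y
    obtain ⟨b, hb⟩ := exists_sub_mem_map A I y
    refine ⟨algebraMap P _ (MvPolynomial.C b), ?_⟩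
    rw [RingHom.comp_apply, eq_comm, Ideal.Quotient.eq, hmap, hΦ]
    have hC : φ (MvPolynomial.C b) = b := MvPolynomial.aeval_C a b
    rwa [hC]
  have : IsNoetherianRing (AdicCompletion J P) :=
    isNoetherianRing_of_ringEquiv (MvPowerSeries (Fin n) A)
      (MvPowerSeries.toAdicCompletionAlgEquiv (Fin n) A).toRingEquiv
  exact isNoetherianRing_of_surjective _ _ Φ hs

lemma height_map_adicCompletion (A : Type*) [CommRing A] [IsNoetherianRing A] (I m : Ideal A)
    [m.IsMaximal] (h : I ≤ m) :
    (m.map (algebraMap A (AdicCompletion I A))).height = m.height := by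
  have := isNoetherianRing_adicCompletion A I
  have hM := AdicCompletion.isMaximal_map_of_le I m h I.fg_of_isNoetherianRing
  have : (m.map (algebraMap A (AdicCompletion I A))).LiesOver m :=
    ⟨Ideal.IsMaximal.eq_of_le ‹_› (Ideal.IsPrime.ne_top inferInstance) Ideal.le_comap_map⟩
  rw [Ideal.height_eq_height_add_of_liesOver_of_hasGoingDown m]
  simp

lemma exists_eq_map_adicCompletion (A : Type*) [CommRing A] [IsNoetherianRing A] (I : Ideal A)
    (M : Ideal (AdicCompletion I A)) [M.IsMaximal] :
    ∃ m : Ideal A, m.IsMaximal ∧ I ≤ m ∧ M = m.map (algebraMap A (AdicCompletion I A)) := by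
  have := AdicCompletion.isAdicComplete_self I I.fg_of_isNoetherianRing
  have hIM : I.map (algebraMap A (AdicCompletion I A)) ≤ M :=
    (IsAdicComplete.le_jacobson_bot _).trans (sInf_le ⟨bot_le, ‹_›⟩)
  have hI : I ≤ M.comap (algebraMap A (AdicCompletion I A)) := Ideal.map_le_iff_le_comap.mp hIM
  have hmax : (M.comap (algebraMap A (AdicCompletion I A))).IsMaximal := by
    let _ := Ideal.Quotient.field M
    have hk := RingHom.ker_isMaximal_of_surjective
      ((Ideal.Quotient.mk M).comp (algebraMap A (AdicCompletion I A))) (by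
        intro y
        obtain ⟨y, rfl⟩ := Ideal.Quotient.mk_surjective y
        obtain ⟨b, hb⟩ := exists_sub_mem_map A I y
        exact ⟨b, ((Ideal.Quotient.eq).mpr (hIM hb)).symm⟩)
    rwa [← RingHom.comap_ker, Ideal.mk_ker] at hk
  refine ⟨_, hmax, hI, ?_⟩
  have hM := AdicCompletion.isMaximal_map_of_le I _ hI I.fg_of_isNoetherianRing
  exact (hM.eq_of_le (Ideal.IsPrime.ne_top inferInstance) Ideal.map_comap_le).symm

/-- Let `A` be a noetherian ring, `I` an ideal of `A`, and let `Â` denote the `I`-adic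
completion of `A`. Then `dim Â = sup_{I ⊆ p prime} dim A_p`; in particular `dim Â ≤ dim A`. -/
theorem dim_adicCompletion (A : Type*) [CommRing A] [IsNoetherianRing A] (I : Ideal A) :
    (ringKrullDim (AdicCompletion I A) =
      ⨆ p : {p : PrimeSpectrum A // I ≤ p.asIdeal},
        ringKrullDim (Localization.AtPrime p.1.asIdeal)) ∧
    ringKrullDim (AdicCompletion I A) ≤ ringKrullDim A := by
  have key : ringKrullDim (AdicCompletion I A) =
      ⨆ p : {p : PrimeSpectrum A // I ≤ p.asIdeal},
        ringKrullDim (Localization.AtPrime p.1.asIdeal) := by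
    apply le_antisymm
    · rw [ringKrullDim_le_iff_isMaximal_height_le]
      intro M hM
      obtain ⟨m, hm, hI, rfl⟩ := exists_eq_map_adicCompletion A I M
      rw [height_map_adicCompletion A I m hI,
        ← IsLocalization.AtPrime.ringKrullDim_eq_height m (Localization.AtPrime m)]
      exact le_iSup (fun p : {p : PrimeSpectrum A // I ≤ p.asIdeal} =>
        ringKrullDim (Localization.AtPrime p.1.asIdeal)) ⟨⟨m, hm.isPrime⟩, hI⟩
    · apply iSup_le
      rintro ⟨p, hp⟩
      rw [IsLocalization.AtPrime.ringKrullDim_eq_height p.asIdeal]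
      obtain ⟨m, hm, hpm⟩ := Ideal.exists_le_maximal p.asIdeal p.isPrime.ne_top
      have hM := AdicCompletion.isMaximal_map_of_le I m (hp.trans hpm) I.fg_of_isNoetherianRing
      have h1 : p.asIdeal.height ≤ (m.map (algebraMap A (AdicCompletion I A))).height := by
        rw [height_map_adicCompletion A I m (hp.trans hpm)]
        exact Ideal.height_mono hpm
      exact (WithBot.coe_le_coe.mpr h1).trans Ideal.height_le_ringKrullDim_of_isPrime
  refine ⟨key, ?_⟩
  rw [key]
  apply iSup_le
  rintro ⟨p, hp⟩
  rw [IsLocalization.AtPrime.ringKrullDim_eq_height p.asIdeal]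
  exact Ideal.height_le_ringKrullDim_of_isPrime
end

section
/- Local flatness criterion for adic rings: let B → A be a continuous homomorphism of noetherian adic rings such that K·A = J for ideals of definition K ⊆ B, J ⊆ A. Then the following are equivalent: (1) A is a flat B-module; (2) A/J^{n+1} is a flat B/K^{n+1}-module for all n; (3) A/J is flat over B/K and Tor_1^B(A, B/K) = 0. -/
open CategoryTheory

universe u

/-- The canonical algebra structure `B/K^(n+1) → A/J^(n+1)` induced by a continuous
homomorphism of preadic rings `B → A` (i.e. one with `K·A ⊆ J`). -/
noncomputable def quotPowAlgebra {A B : Type*} [CommRing A] [CommRing B] [Algebra B A]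
    (K : Ideal B) (J : Ideal A) (h : K ≤ J.comap (algebraMap B A)) (n : ℕ) :
    Algebra (B ⧸ K ^ (n + 1)) (A ⧸ J ^ (n + 1)) :=
  Ideal.Quotient.algebraQuotientOfLEComap (by
    rw [← Ideal.map_le_iff_le_comap, Ideal.map_pow]
    exact Ideal.pow_right_mono (Ideal.map_le_iff_le_comap.mpr h) _)

open TensorProduct

namespace LFC

theorem flat_iff {A B : Type u} [CommRing A] [CommRing B] [Algebra B A]
    (K : Ideal B) (J : Ideal A) (h : K ≤ J.comap (algebraMap B A))
    (hJ : K.map (algebraMap B A) = J) :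
    @Module.Flat (B ⧸ K) (A ⧸ J) _ _ (Ideal.Quotient.algebraQuotientOfLEComap h).toModule ↔
      Module.Flat (B ⧸ K) ((B ⧸ K) ⊗[B] A) := by
  subst hJ
  let := (Ideal.Quotient.algebraQuotientOfLEComap h).toModule
  let e0 := (Algebra.TensorProduct.quotIdealMapEquivQuotTensor A K)
  let e : (A ⧸ K.map (algebraMap B A)) ≃ₗ[B ⧸ K] ((B ⧸ K) ⊗[B] A) :=
    { toFun := e0
      invFun := e0.symm
      left_inv := e0.left_inv
      right_inv := e0.right_inv
      map_add' := map_add e0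
      map_smul' := by
        intro c x
        obtain ⟨c, rfl⟩ := Ideal.Quotient.mk_surjective c
        obtain ⟨x, rfl⟩ := Ideal.Quotient.mk_surjective x
        change e0 (Ideal.Quotient.mk _ (c • x)) = _
        rw [Algebra.TensorProduct.quotIdealMapEquivQuotTensor_mk,
          Algebra.TensorProduct.quotIdealMapEquivQuotTensor_mk]
        simp only [RingHom.id_apply, TensorProduct.smul_tmul', TensorProduct.tmul_smul, smul_eq_mul, mul_one]
        congr 1
        exact (Algebra.algebraMap_eq_smul_one (A := B ⧸ K) c).symm }
  exact Module.Flat.equiv_iff e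

theorem inj_of_killed {A B : Type u} [CommRing A] [CommRing B] [Algebra B A]
    (K : Ideal B) [Module.Flat (B ⧸ K) ((B ⧸ K) ⊗[B] A)]
    {X Y : Type u} [AddCommGroup X] [AddCommGroup Y] [Module B X] [Module B Y]
    (f : X →ₗ[B] Y) (hf : Function.Injective f) (hY : ∀ k ∈ K, ∀ y : Y, k • y = 0) :
    Function.Injective (f.lTensor A) := by
  have hX : ∀ k ∈ K, ∀ x : X, k • x = 0 := fun k hk x => hf (by simp [hY k hk])
  have hY' : Module.IsTorsionBySet B Y K := fun y k => hY k k.2 y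
  have hX' : Module.IsTorsionBySet B X K := fun y k => hX k k.2 y
  let := hY'.module
  let := hX'.module
  have : IsScalarTower B (B ⧸ K) Y := hY'.isScalarTower
  have : IsScalarTower B (B ⧸ K) X := hX'.isScalarTower
  rw [LinearMap.lTensor_inj_iff_rTensor_inj]
  let f' : X →ₗ[B ⧸ K] Y := f.extendScalarsOfSurjective Ideal.Quotient.mk_surjective
  have h1 := Module.Flat.rTensor_preserves_injective_linearMap (M := (B ⧸ K) ⊗[B] A) f' hf
  let eX := (TensorProduct.AlgebraTensorModule.cancelBaseChange B (B ⧸ K) (B ⧸ K) X A)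
  let eY := (TensorProduct.AlgebraTensorModule.cancelBaseChange B (B ⧸ K) (B ⧸ K) Y A)
  have : ∀ z, f.rTensor A z = eY (f'.rTensor _ (eX.symm z)) := by
    intro z
    induction z with
    | zero => simp
    | add a b ha hb => simp only [map_add, ha, hb]
    | tmul x a => simp [eX, eY, f']
  intro a b hab
  rw [this, this] at hab
  exact eX.symm.injective (h1 (eY.injective hab))

section
variable {A B : Type u} [CommRing A] [CommRing B] [Algebra B A]

/-- Transfer of injectivity along a surjection. -/
theorem transfer {F M : Type u} [AddCommGroup F] [AddCommGroup M] [Module B F] [Module B M]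
    (p : F →ₗ[B] M) (hp : Function.Surjective p) (N : Submodule B M)
    (h : Function.Injective ((N.comap p).subtype.lTensor A)) :
    Function.Injective (N.subtype.lTensor A) := by
  rw [injective_iff_map_eq_zero]
  intro x hx
  let r : N.comap p →ₗ[B] N := p.restrict (fun _ h => h)
  have hr : Function.Surjective r := by
    rintro ⟨y, hy⟩
    obtain ⟨z, rfl⟩ := hp y
    exact ⟨⟨z, hy⟩, rfl⟩
  obtain ⟨y, rfl⟩ := LinearMap.lTensor_surjective A hr x
  have hle : LinearMap.ker p ≤ N.comap p := by
    intro z hz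
    rw [Submodule.mem_comap, LinearMap.mem_ker.1 hz]; exact N.zero_mem
  have hex := lTensor_exact A (LinearMap.exact_subtype_ker_map p) hp
  have h1 : p.lTensor A ((N.comap p).subtype.lTensor A y) = 0 := by
    rw [← hx, ← LinearMap.comp_apply, ← LinearMap.comp_apply, ← LinearMap.lTensor_comp,
      ← LinearMap.lTensor_comp]
    rfl
  obtain ⟨z, hz⟩ := (hex _).1 h1
  have h2 : (Submodule.inclusion hle).lTensor A z = y := by
    apply h
    rw [← hz, ← LinearMap.comp_apply, ← LinearMap.lTensor_comp]
    rfl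
  rw [← h2, ← LinearMap.comp_apply, ← LinearMap.lTensor_comp]
  have : r ∘ₗ Submodule.inclusion hle = 0 := by
    ext z
    exact z.2
  rw [this]; simp

theorem free_step (K : Ideal B) [Module.Flat (B ⧸ K) ((B ⧸ K) ⊗[B] A)]
    (hK : Function.Injective ((K.subtype : K →ₗ[B] B).lTensor A))
    {F : Type u} [AddCommGroup F] [Module B F] [Module.Flat B F] (R : Submodule B F)
    (hKF : K • (⊤ : Submodule B F) ≤ R) :
    Function.Injective (R.subtype.lTensor A) := by
  -- the map `K ⊗ F → F`
  let m : K ⊗[B] F →ₗ[B] F := (TensorProduct.lid B F).toLinearMap ∘ₗ K.subtype.rTensor F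
  have hm : LinearMap.range m = K • (⊤ : Submodule B F) := Ideal.subtype_rTensor_range F K
  have hmi : Function.Injective (m.lTensor A) := by
    have h1 : Function.Injective ((K.subtype.lTensor A).rTensor F) :=
      Module.Flat.rTensor_preserves_injective_linearMap _ hK
    have h2 : m.lTensor A = ((TensorProduct.lid B F).lTensor A).toLinearMap ∘ₗ
        (TensorProduct.assoc B A B F).toLinearMap ∘ₗ (K.subtype.lTensor A).rTensor F ∘ₗ
        (TensorProduct.assoc B A K F).symm.toLinearMap := by
      apply TensorProduct.ext'
      intro a z
      induction z with
      | zero => simp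
      | add a b ha hb => simp only [tmul_add, map_add, ha, hb]
      | tmul x a => simp [m]
    rw [h2]
    simp only [LinearMap.coe_comp, LinearEquiv.coe_coe, EmbeddingLike.comp_injective,
      EquivLike.injective_comp]
    exact h1
  let m' : K ⊗[B] F →ₗ[B] R := m.codRestrict R (fun c => hKF (hm ▸ LinearMap.mem_range_self m c))
  let S : Submodule B R := (K • (⊤ : Submodule B F)).comap R.subtype
  let j : (R ⧸ S) →ₗ[B] (F ⧸ (K • (⊤ : Submodule B F))) := S.mapQ _ R.subtype le_rfl
  have hj : Function.Injective j := by
    rw [← LinearMap.ker_eq_bot, Submodule.ker_mapQ, eq_bot_iff]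
    rintro _ ⟨x, hx, rfl⟩
    rw [Submodule.mem_bot]
    exact (Submodule.Quotient.mk_eq_zero S).2 hx
  have hj' : Function.Injective (j.lTensor A) := by
    apply inj_of_killed K j hj
    intro k hk y
    obtain ⟨y, rfl⟩ := Submodule.mkQ_surjective _ y
    rw [← map_smul, Submodule.mkQ_apply, Submodule.Quotient.mk_eq_zero]
    exact Submodule.smul_mem_smul hk trivial
  have hex : Function.Exact m' S.mkQ := by
    rw [LinearMap.exact_iff, Submodule.ker_mkQ]
    ext x
    constructor
    · intro hx
      have hx : (x : F) ∈ K • (⊤ : Submodule B F) := hx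
      rw [← hm] at hx
      obtain ⟨z, hz⟩ := hx
      exact ⟨z, Subtype.ext hz⟩
    · rintro ⟨z, rfl⟩
      change m z ∈ K • (⊤ : Submodule B F)
      rw [← hm]
      exact ⟨z, rfl⟩
  rw [injective_iff_map_eq_zero]
  intro x hx
  have h1 : S.mkQ.lTensor A x = 0 := by
    apply hj'
    rw [map_zero, ← LinearMap.comp_apply, ← LinearMap.lTensor_comp, Submodule.mapQ_mkQ,
      LinearMap.lTensor_comp, LinearMap.comp_apply, hx, map_zero]
  obtain ⟨y, rfl⟩ := (lTensor_exact A hex S.mkQ_surjective _).1 h1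
  have h2 : m.lTensor A y = 0 := by
    rw [← hx, ← LinearMap.comp_apply, ← LinearMap.lTensor_comp]
    rfl
  rw [hmi (h2.trans (map_zero _).symm), map_zero]

theorem base_step (K : Ideal B) [Module.Flat (B ⧸ K) ((B ⧸ K) ⊗[B] A)]
    (hK : Function.Injective ((K.subtype : K →ₗ[B] B).lTensor A))
    {M : Type u} [AddCommGroup M] [Module B M] (N : Submodule B M)
    (hN : K • (⊤ : Submodule B M) ≤ N) :
    Function.Injective (N.subtype.lTensor A) := by
  let p : (M →₀ B) →ₗ[B] M := Finsupp.linearCombination B id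
  have hp : Function.Surjective p := Finsupp.linearCombination_id_surjective B M
  apply transfer p hp
  apply free_step K hK
  rw [← Submodule.map_le_iff_le_comap, Submodule.map_smul'']
  exact le_trans (Submodule.smul_mono le_rfl le_top) hN

theorem ind_step (K : Ideal B) [Module.Flat (B ⧸ K) ((B ⧸ K) ⊗[B] A)]
    (hK : Function.Injective ((K.subtype : K →ₗ[B] B).lTensor A)) (n : ℕ) :
    ∀ {M : Type u} [AddCommGroup M] [Module B M] (N : Submodule B M)
    (_ : K ^ n • (⊤ : Submodule B M) ≤ N), Function.Injective (N.subtype.lTensor A) := by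
  induction n with
  | zero =>
    intro M _ _ N hN
    apply base_step K hK N
    refine le_trans ?_ hN
    simp
  | succ n ih =>
    intro M _ _ N hN
    let N2 : Submodule B M := N ⊔ K • ⊤
    have h1 : Function.Injective (N2.subtype.lTensor A) := base_step K hK N2 le_sup_right
    have h2 := ih (M := N2) (N.comap N2.subtype) (by
      rw [← Submodule.map_le_iff_le_comap, Submodule.map_smul'', Submodule.map_subtype_top,
        Submodule.smul_sup, ← mul_smul, ← pow_succ]
      exact sup_le Submodule.smul_le_right hN)
    let e : N →ₗ[B] N.comap N2.subtype :=
      LinearMap.codRestrict _ (Submodule.inclusion (le_sup_left : N ≤ N2)) (fun c => c.2)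
    let e' : N.comap N2.subtype →ₗ[B] N :=
      LinearMap.codRestrict _ (N2.subtype ∘ₗ (N.comap N2.subtype).subtype) (fun c => c.2)
    have h3 : Function.Injective (e.lTensor A) := by
      apply Function.LeftInverse.injective (g := e'.lTensor A)
      intro x
      rw [← LinearMap.comp_apply, ← LinearMap.lTensor_comp]
      have : e' ∘ₗ e = LinearMap.id := by ext; rfl
      simp [this]
    have h4 : N.subtype = N2.subtype ∘ₗ (N.comap N2.subtype).subtype ∘ₗ e := rfl
    rw [h4, LinearMap.lTensor_comp, LinearMap.lTensor_comp]
    exact h1.comp (h2.comp h3)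

theorem tmul_mem (I K : Ideal B) (m : ℕ) (a : A) (w : I) (hw : w ∈ K ^ m • (⊤ : Submodule B I)) :
    a ⊗ₜ[B] w ∈ (K.map (algebraMap B A)) ^ m • (⊤ : Submodule A (A ⊗[B] I)) := by
  induction hw using Submodule.smul_induction_on' with
  | smul r hr n hn =>
    rw [← TensorProduct.smul_tmul, Algebra.smul_def, ← smul_eq_mul, ← TensorProduct.smul_tmul']
    refine Submodule.smul_mem_smul ?_ trivial
    rw [← Ideal.map_pow]
    exact Ideal.mem_map_of_mem _ hr
  | add x hx y hy h1 h2 => rw [tmul_add]; exact add_mem h1 h2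

theorem flat_of (K : Ideal B) [IsNoetherianRing A] [IsNoetherianRing B]
    [IsAdicComplete (K.map (algebraMap B A)) A]
    (H : ∀ n (N : Submodule B (B ⧸ K ^ (n + 1))), Function.Injective (N.subtype.lTensor A)) :
    Module.Flat B A := by
  rw [Module.Flat.iff_lTensor_injective]
  intro I _
  rw [injective_iff_map_eq_zero]
  intro x hx
  have hkr := Ideal.iInf_pow_smul_eq_bot_of_le_jacobson (M := A ⊗[B] I)
    (K.map (algebraMap B A)) (IsAdicComplete.le_jacobson_bot _)
  rw [← Submodule.mem_bot A, ← hkr, Submodule.mem_iInf]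
  intro m
  obtain ⟨k, hk⟩ := Ideal.exists_pow_inf_eq_pow_smul K (I : Submodule B B)
  set n := m + k
  have hn := hk (n + 1) (by omega)
  let Q := (K ^ (n + 1) : Submodule B B)
  let N : Submodule B (B ⧸ K ^ (n + 1)) := Submodule.map (Submodule.mkQ Q) I
  let q : I →ₗ[B] N := (Submodule.mkQ Q).restrict (fun c hc => Submodule.mem_map_of_mem hc)
  have hq : Function.Surjective q := by
    rintro ⟨_, y, hy, rfl⟩
    exact ⟨⟨y, hy⟩, rfl⟩
  have h1 : q.lTensor A x = 0 := by
    apply H n N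
    rw [map_zero, ← LinearMap.comp_apply, ← LinearMap.lTensor_comp]
    have : N.subtype ∘ₗ q = Submodule.mkQ Q ∘ₗ I.subtype := rfl
    rw [this, LinearMap.lTensor_comp, LinearMap.comp_apply, hx, map_zero]
  obtain ⟨z, rfl⟩ := (lTensor_exact A (LinearMap.exact_subtype_ker_map q) hq _).1 h1
  have hker : ∀ w : I, q w = 0 → w ∈ K ^ m • (⊤ : Submodule B I) := by
    intro w hw
    have hw1 : (w : B) ∈ K ^ (n + 1) := by
      have := congrArg Subtype.val hw
      exact (Submodule.Quotient.mk_eq_zero Q).1 this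
    have hw2 : (w : B) ∈ K ^ (n + 1) • (⊤ : Submodule B B) ⊓ I := ⟨by simpa using hw1, w.2⟩
    rw [hn] at hw2
    have hw3 : (w : B) ∈ K ^ m • (I : Submodule B B) :=
      Submodule.smul_mono (Ideal.pow_le_pow_right (by omega)) inf_le_right hw2
    have : (K ^ m • (⊤ : Submodule B I)).map (Submodule.subtype I) = K ^ m • (I : Submodule B B) := by
      rw [Submodule.map_smul'', Submodule.map_subtype_top]
    rw [← this] at hw3
    obtain ⟨w', h, h'⟩ := hw3
    rwa [← Subtype.ext (a1 := w') (a2 := w) h']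
  clear hx h1
  induction z with
  | zero => simp
  | add a b ha hb => rw [map_add]; exact add_mem ha hb
  | tmul a w => exact tmul_mem I K m a w (hker _ w.2)

theorem tor_iff (K : Ideal B) (P : ProjectiveResolution (ModuleCat.of B (B ⧸ K))) :
    Limits.IsZero (((Tor (ModuleCat B) 1).obj (ModuleCat.of B A)).obj
          (ModuleCat.of B (B ⧸ K))) ↔
      Function.Exact ((P.complex.d 2 1).hom.lTensor A) ((P.complex.d 1 0).hom.lTensor A) := by
  rw [Tor_obj, (P.isoLeftDerivedObj _ 1).isZero_iff]
  erw [← HomologicalComplex.exactAt_iff_isZero_homology]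
  rw [HomologicalComplex.exactAt_iff' _ 2 1 0 (by simp) (by simp),
    ShortComplex.ShortExact.moduleCat_exact_iff_function_exact]
  rfl

theorem tor_zero_of_flat (K : Ideal B) [Module.Flat B A] :
    Limits.IsZero (((Tor (ModuleCat B) 1).obj (ModuleCat.of B A)).obj
          (ModuleCat.of B (B ⧸ K))) := by
  let P := projectiveResolution (ModuleCat.of B (B ⧸ K))
  rw [tor_iff K P]
  apply Module.Flat.lTensor_exact
  have := P.exact_succ 0
  rwa [ShortComplex.ShortExact.moduleCat_exact_iff_function_exact] at this

theorem inj_of_tor (K : Ideal B) (h : Limits.IsZero (((Tor (ModuleCat B) 1).obj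
    (ModuleCat.of B A)).obj (ModuleCat.of B (B ⧸ K)))) :
    Function.Injective ((K.subtype : K →ₗ[B] B).lTensor A) := by
  let P := projectiveResolution (ModuleCat.of B (B ⧸ K))
  rw [tor_iff K P] at h
  let d2 : P.complex.X 2 →ₗ[B] P.complex.X 1 := (P.complex.d 2 1).hom
  let d1 : P.complex.X 1 →ₗ[B] P.complex.X 0 := (P.complex.d 1 0).hom
  let ε : P.complex.X 0 →ₗ[B] (B ⧸ K) := (P.π.f 0).hom
  have hε : Function.Surjective ε :=
    (ModuleCat.epi_iff_surjective (P.π.f 0)).1 inferInstance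
  have hex0 : Function.Exact d1 ε := by
    have : (ShortComplex.mk _ _ P.complex_d_comp_π_f_zero).Exact :=
      ShortComplex.exact_of_g_is_cokernel _ P.isColimitCokernelCofork
    rwa [ShortComplex.ShortExact.moduleCat_exact_iff_function_exact] at this
  have hex1 : d1 ∘ₗ d2 = 0 := by
    have := P.complex.d_comp_d 2 1 0
    exact congrArg ModuleCat.Hom.hom this
  have hproj : Module.Projective B (P.complex.X 0) :=
    (IsProjective.iff_projective _).2 (P.projective 0)
  let S := LinearMap.ker ε
  let d1' : P.complex.X 1 →ₗ[B] S := d1.codRestrict S (fun c => hex0.apply_apply_eq_zero c)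
  have hd1' : Function.Surjective d1' := by
    rintro ⟨y, hy⟩
    obtain ⟨z, hz⟩ := (hex0 y).1 hy
    exact ⟨z, Subtype.ext hz⟩
  have hS : ∀ x, S.subtype.lTensor A x = 0 → x = 0 := by
    intro x hx
    obtain ⟨y, rfl⟩ := LinearMap.lTensor_surjective A hd1' x
    have : d1.lTensor A y = 0 := by
      rw [← hx, ← LinearMap.comp_apply, ← LinearMap.lTensor_comp]; rfl
    obtain ⟨z, rfl⟩ := (h y).1 this
    rw [← LinearMap.comp_apply]
    erw [← LinearMap.lTensor_comp]
    have : d1' ∘ₗ d2 = 0 := by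
      ext z
      exact congrArg Subtype.val (Subtype.ext (LinearMap.congr_fun hex1 z) : d1' (d2 z) = 0)
    erw [this]
    simp
  obtain ⟨g, hg⟩ := Module.projective_lifting_property ε (Submodule.mkQ K) hε
  obtain ⟨f, hf⟩ := Module.projective_lifting_property (Submodule.mkQ K) ε (Submodule.mkQ_surjective K)
  have hg' : ∀ b, ε (g b) = Submodule.mkQ K b := fun b => LinearMap.congr_fun hg b
  have hf' : ∀ b, Submodule.mkQ K (f b) = ε b := fun b => LinearMap.congr_fun hf b
  let gK : K →ₗ[B] S := g.restrict (fun c hc => by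
    rw [LinearMap.mem_ker, hg']; exact (Submodule.Quotient.mk_eq_zero K).2 hc)
  let fS : S →ₗ[B] K := f.restrict (fun c hc => by
    rw [← Submodule.Quotient.mk_eq_zero K]; exact (hf' c).trans hc)
  let t : B →ₗ[B] K := (LinearMap.id - f ∘ₗ g).codRestrict K (fun c => by
    rw [← Submodule.Quotient.mk_eq_zero K, ← Submodule.mkQ_apply]
    simp only [LinearMap.sub_apply, LinearMap.comp_apply, map_sub, hf', hg', LinearMap.id_apply, sub_self])
  have hid : (LinearMap.id : K →ₗ[B] K) = fS ∘ₗ gK + t ∘ₗ K.subtype := by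
    ext c
    simp [fS, gK, t]
  rw [injective_iff_map_eq_zero]
  intro x hx
  have h1 : gK.lTensor A x = 0 := by
    apply hS
    rw [← LinearMap.comp_apply, ← LinearMap.lTensor_comp]
    have : S.subtype ∘ₗ gK = g ∘ₗ K.subtype := rfl
    rw [this, LinearMap.lTensor_comp, LinearMap.comp_apply, hx, map_zero]
  have h2 : x = (LinearMap.id : K →ₗ[B] K).lTensor A x := by simp
  rw [h2, hid, LinearMap.lTensor_add, LinearMap.lTensor_comp, LinearMap.lTensor_comp,
    LinearMap.add_apply, LinearMap.comp_apply, LinearMap.comp_apply, h1, hx, map_zero, map_zero,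
    add_zero]

end

end LFC

/-- Local flatness criterion for adic rings: let `B → A` be a continuous homomorphism of
noetherian adic rings such that `K·A = J` for ideals of definition `K ⊆ B`, `J ⊆ A`
(so `J = K·A` and both rings are complete). Then the following are equivalent:
(1) `A` is a flat `B`-module; (2) `A/J^(n+1)` is a flat `B/K^(n+1)`-module for all `n`;
(3) `A/J` is flat over `B/K` and `Tor₁^B(A, B/K) = 0`. -/
theorem local_flatness_criterion_adic (A B : Type u) [CommRing A] [CommRing B] [Algebra B A]
    [IsNoetherianRing A] [IsNoetherianRing B] (K : Ideal B) [IsAdicComplete K B]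
    [IsAdicComplete (K.map (algebraMap B A)) A] :
    (Module.Flat B A ↔
      ∀ n : ℕ, @Module.Flat (B ⧸ K ^ (n + 1)) (A ⧸ (K.map (algebraMap B A)) ^ (n + 1)) _ _
        (quotPowAlgebra K (K.map (algebraMap B A)) Ideal.le_comap_map n).toModule) ∧
    (Module.Flat B A ↔
      (@Module.Flat (B ⧸ K) (A ⧸ K.map (algebraMap B A)) _ _
          (Ideal.Quotient.algebraQuotientOfLEComap
            (Ideal.le_comap_map : K ≤ Ideal.comap (algebraMap B A)
              (K.map (algebraMap B A)))).toModule ∧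
        Limits.IsZero (((Tor (ModuleCat B) 1).obj (ModuleCat.of B A)).obj
          (ModuleCat.of B (B ⧸ K))))) := by
  have key : ∀ n, (@Module.Flat (B ⧸ K ^ (n + 1)) (A ⧸ (K.map (algebraMap B A)) ^ (n + 1)) _ _
        (quotPowAlgebra K (K.map (algebraMap B A)) Ideal.le_comap_map n).toModule) ↔
      Module.Flat (B ⧸ K ^ (n + 1)) ((B ⧸ K ^ (n + 1)) ⊗[B] A) := fun n =>
    LFC.flat_iff (K ^ (n + 1)) _ _ (Ideal.map_pow _ _ _)
  have key0 := LFC.flat_iff (A := A) K (K.map (algebraMap B A)) Ideal.le_comap_map rfl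
  refine ⟨⟨fun h n => (key n).2 inferInstance, fun h => ?_⟩,
    ⟨fun h => ⟨key0.2 inferInstance, LFC.tor_zero_of_flat K⟩, fun h => ?_⟩⟩
  · apply LFC.flat_of K
    intro n N
    have := (key n).1 (h n)
    apply LFC.inj_of_killed (K ^ (n + 1)) N.subtype N.injective_subtype
    intro k hk y
    obtain ⟨y, rfl⟩ := Ideal.Quotient.mk_surjective y
    rw [← Ideal.Quotient.mkₐ_eq_mk B, ← map_smul, Ideal.Quotient.mkₐ_eq_mk,
      Ideal.Quotient.eq_zero_iff_mem]
    exact Ideal.mul_mem_right _ _ hk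
  · have := key0.1 h.1
    apply LFC.flat_of K
    intro n N
    apply LFC.ind_step K (LFC.inj_of_tor K h.2) (n + 1)
    rw [Submodule.smul_le]
    intro k hk y _
    obtain ⟨y, rfl⟩ := Ideal.Quotient.mk_surjective y
    rw [← Ideal.Quotient.mkₐ_eq_mk B, ← map_smul, Ideal.Quotient.mkₐ_eq_mk,
      smul_eq_mul, Ideal.Quotient.eq_zero_iff_mem.2 (Ideal.mul_mem_right _ _ hk)]
    exact N.zero_mem
end

section
/- Let B → A be a continuous homomorphism of preadic rings with ideal of definition J ⊆ A, such that A is a formally smooth B-algebra. Then Ω¹_{A/B} ⊗_A A/J is a projective A/J-module; moreover if the completed module of differentials Ω̂¹_{A/B} is a finitely generated A-module and A is J-adically complete noetherian, then Ω̂¹_{A/B} is a projective A-module. -/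
universe uB uA uC

/-- A continuous homomorphism `f : B → A` of preadic rings (with ideals of definition `K`, `J`)
is *formally smooth* if for every discrete ring `C`, every continuous homomorphism `B → C`
(i.e. one killing some power of `K`), and every square-zero ideal `I ⊆ C`, every continuous
`B`-algebra homomorphism `A → C/I` lifts to a continuous `B`-algebra homomorphism `A → C`. -/
def IsFormallySmoothPreadic {B : Type uB} {A : Type uA} [CommRing B] [CommRing A] (f : B →+* A)
    (K : Ideal B) (J : Ideal A) : Prop :=
  ∀ (C : Type uC) [CommRing C] (φ : B →+* C), (∃ m : ℕ, K ^ m ≤ RingHom.ker φ) →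
    ∀ I : Ideal C, I ^ 2 = ⊥ →
      ∀ u : A →+* C ⧸ I, u.comp f = (Ideal.Quotient.mk I).comp φ →
        (∃ m : ℕ, J ^ m ≤ RingHom.ker u) →
        ∃ v : A →+* C, v.comp f = φ ∧ (Ideal.Quotient.mk I).comp v = u ∧
          ∃ m : ℕ, J ^ m ≤ RingHom.ker v

/-- A continuous homomorphism `f : B → A` of preadic rings (with ideals of definition `K`, `J`)
is *formally unramified* if for every discrete ring `C`, every continuous homomorphism `B → C`,
and every square-zero ideal `I ⊆ C`, any two continuous `B`-algebra homomorphisms `A → C`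
inducing the same map `A → C/I` coincide. -/
def IsFormallyUnramifiedPreadic {B : Type uB} {A : Type uA} [CommRing B] [CommRing A]
    (f : B →+* A) (K : Ideal B) (J : Ideal A) : Prop :=
  ∀ (C : Type uC) [CommRing C] (φ : B →+* C), (∃ m : ℕ, K ^ m ≤ RingHom.ker φ) →
    ∀ I : Ideal C, I ^ 2 = ⊥ →
      ∀ v w : A →+* C, v.comp f = φ → w.comp f = φ →
        (∃ m : ℕ, J ^ m ≤ RingHom.ker v) → (∃ m : ℕ, J ^ m ≤ RingHom.ker w) →
        (Ideal.Quotient.mk I).comp v = (Ideal.Quotient.mk I).comp w → v = w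

/-- A continuous homomorphism of preadic rings is *formally étale* if it is both formally
smooth and formally unramified, i.e. the continuous lifting against square-zero extensions of
discrete topological algebras is bijective. -/
def IsFormallyEtalePreadic {B : Type uB} {A : Type uA} [CommRing B] [CommRing A] (f : B →+* A)
    (K : Ideal B) (J : Ideal A) : Prop :=
  IsFormallySmoothPreadic.{uB, uA, uC} f K J ∧ IsFormallyUnramifiedPreadic.{uB, uA, uC} f K J

open TrivSqZeroExt in
/-- Lifting property of differentials against maps of modules killed by a power of `J`. -/
theorem kaehler_lift_of_isFormallySmoothPreadic {B : Type uB} {A : Type uA}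
    [CommRing B] [CommRing A] [Algebra B A] (K : Ideal B) (J : Ideal A)
    (hcont : K.map (algebraMap B A) ≤ J)
    (hsm : IsFormallySmoothPreadic.{uB, uA, uA} (algebraMap B A) K J)
    (n : ℕ) {M : Type uA} {N : Type*} [AddCommGroup M] [AddCommGroup N] [Module A M] [Module A N]
    (hM : ∀ a ∈ J ^ n, ∀ m : M, a • m = 0)
    (p : M →ₗ[A] N) (g : KaehlerDifferential B A →ₗ[A] N) (hg : ∀ x, ∃ m, p m = g x) :
    ∃ h : KaehlerDifferential B A →ₗ[A] M, ∀ x, p (h x) = g x := by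
  let _ : Module B M := Module.compHom M (algebraMap B A)
  have : IsScalarTower B A M := ⟨fun b a m => by
    rw [Algebra.smul_def, mul_smul]; rfl⟩
  have hT : Module.IsTorsionBySet A M (J ^ n : Ideal A) := fun m a => hM a a.2 m
  let _ : Module (A ⧸ J ^ n) M := hT.module
  have hmk : ∀ (a : A) (m : M), (Ideal.Quotient.mk (J ^ n) a) • m = a • m := fun a m => rfl
  let _ : Module (A ⧸ J ^ n)ᵐᵒᵖ M :=
    Module.compHom M ((RingHom.id (A ⧸ J ^ n)).fromOpposite fun _ _ => mul_comm _ _)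
  have : IsCentralScalar (A ⧸ J ^ n) M := ⟨fun _ _ => rfl⟩
  have hp : ∀ (r : A ⧸ J ^ n) (m : M), p m = 0 → p (r • m) = 0 := by
    intro r m h
    obtain ⟨a, rfl⟩ := Ideal.Quotient.mk_surjective r
    rw [hmk, map_smul, h, smul_zero]
  let I : Ideal (TrivSqZeroExt (A ⧸ J ^ n) M) :=
    { carrier := {c | c.fst = 0 ∧ p c.snd = 0}
      add_mem' := by
        rintro x y ⟨h1, h2⟩ ⟨h3, h4⟩
        simp [h1, h2, h3, h4]
      zero_mem' := by simp
      smul_mem' := by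
        rintro c x ⟨h1, h2⟩
        simp [h1, hp _ _ h2] }
  have hI : ∀ c, c ∈ I ↔ c.fst = 0 ∧ p c.snd = 0 := fun c => Iff.rfl
  have hI2 : I ^ 2 = ⊥ := by
    rw [eq_bot_iff, pow_two, Ideal.mul_le]
    intro r hr s hs
    rw [Ideal.mem_bot]
    ext <;> simp [((hI _).1 hr).1, ((hI _).1 hs).1]
  let φ : B →+* TrivSqZeroExt (A ⧸ J ^ n) M :=
    (inlHom (A ⧸ J ^ n) M).comp ((Ideal.Quotient.mk (J ^ n)).comp (algebraMap B A))
  have hφ : ∀ b, φ b = inl (Ideal.Quotient.mk (J ^ n) (algebraMap B A b)) := fun b => rfl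
  choose t ht using fun a : A => hg (KaehlerDifferential.D B A a)
  let e : A → TrivSqZeroExt (A ⧸ J ^ n) M := fun a => inl (Ideal.Quotient.mk (J ^ n) a) + inr (t a)
  have he1 : ∀ a, (e a).fst = Ideal.Quotient.mk (J ^ n) a := fun a => by simp [e]
  have he2 : ∀ a, (e a).snd = t a := fun a => by simp [e]
  have heq : ∀ x y, Ideal.Quotient.mk I x = Ideal.Quotient.mk I y ↔
      x.fst = y.fst ∧ p x.snd = p y.snd := by
    intro x y
    rw [Ideal.Quotient.eq, hI]
    simp [sub_eq_zero]
  let u : A →+* (TrivSqZeroExt (A ⧸ J ^ n) M) ⧸ I :=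
    { toFun := fun a => Ideal.Quotient.mk I (e a)
      map_one' := by
        rw [← map_one (Ideal.Quotient.mk I), heq]
        simp [he1, he2, ht]
      map_zero' := by
        rw [← map_zero (Ideal.Quotient.mk I), heq]
        simp [he1, he2, ht]
      map_mul' := fun x y => by
        rw [← map_mul (Ideal.Quotient.mk I), heq]
        simp [he1, he2, ht, hmk]
      map_add' := fun x y => by
        rw [← map_add (Ideal.Quotient.mk I), heq]
        simp [he1, he2, ht] }
  have hu : ∀ a, u a = Ideal.Quotient.mk I (e a) := fun a => rfl
  obtain ⟨v, hv1, hv2, -⟩ := hsm (TrivSqZeroExt (A ⧸ J ^ n) M) φ ⟨n, by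
      intro b hb
      rw [RingHom.mem_ker, hφ, Ideal.Quotient.eq_zero_iff_mem.2, inl_zero]
      refine Ideal.pow_right_mono hcont n ?_
      rw [← Ideal.map_pow]
      exact Ideal.mem_map_of_mem _ hb⟩ I hI2 u (by
      ext b
      rw [RingHom.comp_apply, RingHom.comp_apply, hu, heq]
      simp [he1, he2, ht, hφ]) ⟨n + n, by
      rw [pow_add, Ideal.mul_le]
      intro r hr s hs
      rw [RingHom.mem_ker, map_mul, hu, hu, ← map_mul, ← map_zero (Ideal.Quotient.mk I)]
      congr 1
      ext <;> simp [he1, he2, Ideal.Quotient.eq_zero_iff_mem.2 hr,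
        Ideal.Quotient.eq_zero_iff_mem.2 hs]⟩
  have hv : ∀ a, (v a).fst = Ideal.Quotient.mk (J ^ n) a ∧
      p (v a).snd = g (KaehlerDifferential.D B A a) := by
    intro a
    have := RingHom.congr_fun hv2 a
    rw [RingHom.comp_apply, hu, heq, he1, he2, ht] at this
    exact this
  have hvb : ∀ b, v (algebraMap B A b) = φ b := fun b => RingHom.congr_fun hv1 b
  have hmul : ∀ a b, (v (a * b)).snd = a • (v b).snd + b • (v a).snd := by
    intro a b
    rw [map_mul, snd_mul, (hv a).1, (hv b).1, hmk, op_smul_eq_smul, hmk]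
  let D : Derivation B A M := Derivation.mk'
    { toFun := fun a => (v a).snd
      map_add' := fun x y => by simp
      map_smul' := fun b x => by
        rw [Algebra.smul_def, hmul, hvb, hφ, snd_inl, smul_zero, add_zero]
        rfl } hmul
  have hD : ∀ a, D a = (v a).snd := fun a => rfl
  refine ⟨D.liftKaehlerDifferential, fun x => ?_⟩
  have hx : x ∈ Submodule.span A (Set.range (KaehlerDifferential.D B A)) := by
    rw [KaehlerDifferential.span_range_derivation]; trivial
  induction hx using Submodule.span_induction with
  | mem x hx =>
    obtain ⟨a, rfl⟩ := hx
    rw [Derivation.liftKaehlerDifferential_comp_D, hD, (hv a).2]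
  | zero => simp
  | add x y _ _ h1 h2 => simp [h1, h2]
  | smul a x _ h => simp [h]

/-- A finite free module over a complete ring is complete. -/
theorem isAdicComplete_fin_fun {A : Type*} [CommRing A] (J : Ideal A) [IsAdicComplete J A]
    (k : ℕ) : IsAdicComplete J (Fin k → A) := by
  rw [← AdicCompletion.of_bijective_iff]
  have h := (AdicCompletion.piEquivOfFintype J (fun _ : Fin k => A)).bijective
  rw [← Function.Bijective.of_comp_iff' h]
  have h2 : (AdicCompletion.piEquivOfFintype J (fun _ : Fin k => A)) ∘
      (AdicCompletion.of J (Fin k → A)) = Pi.map (fun _ => AdicCompletion.of J A) := by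
    ext x i n
    simp
    rfl
  rw [h2]
  exact Function.Bijective.piMap fun _ => AdicCompletion.of_bijective J A

/-- Projectivity of a finite completion over a complete ring from the lifting property. -/
theorem projective_adicCompletion_of_lift {A : Type uA} [CommRing A] (J : Ideal A)
    [IsAdicComplete J A] {W : Type uA} [AddCommGroup W] [Module A W]
    (hL : ∀ (n : ℕ) (M N : Type uA) [AddCommGroup M] [AddCommGroup N] [Module A M] [Module A N]
      (_ : ∀ a ∈ J ^ n, ∀ m : M, a • m = 0)
      (p : M →ₗ[A] N) (g : W →ₗ[A] N) (_ : ∀ x, ∃ m, p m = g x),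
      ∃ h : W →ₗ[A] M, ∀ x, p (h x) = g x)
    [Module.Finite A (AdicCompletion J W)] : Module.Projective A (AdicCompletion J W) := by
  obtain ⟨k, π, hπ⟩ := Module.Finite.exists_fin' A (AdicCompletion J W)
  have := isAdicComplete_fin_fun J k
  have hq : ∀ n, (J ^ n • ⊤ : Submodule A (Fin k → A)) ≤
      LinearMap.ker ((AdicCompletion.eval J W n).comp π) := by
    intro n
    rw [LinearMap.ker_comp, ← Submodule.map_le_iff_le_comap, Submodule.map_smul'']
    exact (Submodule.smul_mono le_rfl le_top).trans (AdicCompletion.pow_smul_top_le_ker_eval ..)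
  let q : ∀ n, ((Fin k → A) ⧸ (J ^ n • ⊤ : Submodule A (Fin k → A))) →ₗ[A]
      W ⧸ (J ^ n • ⊤ : Submodule A W) := fun n => Submodule.liftQ _ _ (hq n)
  have hqmk : ∀ n x, q n (Submodule.Quotient.mk x) = (π x).val n := fun n x => rfl
  have step : ∀ n (s : W →ₗ[A] ((Fin k → A) ⧸ (J ^ n • ⊤ : Submodule A (Fin k → A)))),
      (∀ x, q n (s x) = Submodule.Quotient.mk x) →
      ∃ s' : W →ₗ[A] ((Fin k → A) ⧸ (J ^ (n + 1) • ⊤ : Submodule A (Fin k → A))),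
        (∀ x, q (n + 1) (s' x) = Submodule.Quotient.mk x) ∧
        ∀ x, Submodule.factorPow J (Fin k → A) n.le_succ (s' x) = s x := by
    intro n s hs
    obtain ⟨h, hh⟩ := hL (n + 1) ((Fin k → A) ⧸ (J ^ (n + 1) • ⊤ : Submodule A (Fin k → A))) _
      (by
        intro a ha m
        obtain ⟨m, rfl⟩ := Submodule.Quotient.mk_surjective _ m
        rw [← Submodule.Quotient.mk_smul, Submodule.Quotient.mk_eq_zero]
        exact Submodule.smul_mem_smul ha trivial)
      ((q (n + 1)).prod (Submodule.factorPow J (Fin k → A) n.le_succ))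
      ((Submodule.mkQ (J ^ (n + 1) • ⊤ : Submodule A W)).prod s) (by
        intro x
        obtain ⟨y, hy⟩ := Submodule.Quotient.mk_surjective _ (s x)
        have h1 : (π y).val n = Submodule.Quotient.mk x := by
          rw [← hqmk, hy, hs]
        obtain ⟨x', hx'⟩ := hπ (AdicCompletion.of J W x)
        have h2 : (π (y - x')).val n = 0 := by
          rw [map_sub, AdicCompletion.val_sub_apply, h1, hx']
          simp
        obtain ⟨w, hw⟩ := Submodule.Quotient.mk_surjective _ ((π (y - x')).val (n + 1))
        have h3 : w ∈ (J ^ n • ⊤ : Submodule A W) := by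
          rw [← Submodule.Quotient.mk_eq_zero, ← h2,
            ← AdicCompletion.transitionMap_comp_eval_apply J W n.le_succ, ← hw]
          rfl
        have h4 : ∃ z ∈ (J ^ n • ⊤ : Submodule A (Fin k → A)),
            (π z).val (n + 1) = Submodule.Quotient.mk w := by
          have : w ∈ (J ^ n • ⊤ : Submodule A W) → Submodule.Quotient.mk w ∈
              (J ^ n • ⊤ : Submodule A (Fin k → A)).map
                ((AdicCompletion.eval J W (n + 1)).comp π) := by
            intro hw
            have hsurj : Function.Surjective ((AdicCompletion.eval J W (n + 1)).comp π) := by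
              rw [LinearMap.coe_comp]
              exact (AdicCompletion.eval_surjective J W (n + 1)).comp hπ
            rw [Submodule.map_smul'', Submodule.map_top, LinearMap.range_eq_top.2 hsurj,
              ← Submodule.range_mkQ (J ^ (n + 1) • ⊤ : Submodule A W), ← Submodule.map_top,
              ← Submodule.map_smul'']
            exact Submodule.mem_map_of_mem hw
          exact this h3
        obtain ⟨z, hz, hz'⟩ := h4
        refine ⟨Submodule.Quotient.mk (y - z), ?_⟩
        rw [LinearMap.prod_apply, LinearMap.prod_apply]
        refine Prod.ext ?_ ?_
        · change q (n + 1) _ = Submodule.Quotient.mk x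
          rw [hqmk, map_sub, AdicCompletion.val_sub_apply, hz', hw, map_sub,
            AdicCompletion.val_sub_apply, hx', sub_sub_cancel]
          rfl
        · change (Submodule.Quotient.mk (y - z) : (Fin k → A) ⧸ _) = s x
          rw [← hy, Submodule.Quotient.eq]
          simpa using hz)
    refine ⟨h, fun x => congrArg Prod.fst (hh x), fun x => congrArg Prod.snd (hh x)⟩
  let S : ∀ n, {s : W →ₗ[A] ((Fin k → A) ⧸ (J ^ n • ⊤ : Submodule A (Fin k → A))) //
      ∀ x, q n (s x) = Submodule.Quotient.mk x} := fun n => Nat.rec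
    ⟨0, fun x => by
      have : Subsingleton (W ⧸ (J ^ 0 • ⊤ : Submodule A W)) := by
        apply Submodule.Quotient.subsingleton_iff.2; simp
      exact Subsingleton.elim _ _⟩
    (fun n s => ⟨(step n s.1 s.2).choose, (step n s.1 s.2).choose_spec.1⟩) n
  have hS : ∀ n x, Submodule.factorPow J (Fin k → A) n.le_succ ((S (n + 1)).1 x) = (S n).1 x :=
    fun n => (step n (S n).1 (S n).2).choose_spec.2
  have hker : ∀ n, (J ^ n • ⊤ : Submodule A W) ≤ LinearMap.ker (S n).1 := by
    intro n
    rw [Submodule.smul_le]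
    intro a ha x _
    rw [LinearMap.mem_ker, map_smul]
    obtain ⟨m, hm⟩ := Submodule.Quotient.mk_surjective _ ((S n).1 x)
    rw [← hm, ← Submodule.Quotient.mk_smul, Submodule.Quotient.mk_eq_zero]
    exact Submodule.smul_mem_smul ha trivial
  let f : ∀ n, AdicCompletion J W →ₗ[A] ((Fin k → A) ⧸ (J ^ n • ⊤ : Submodule A (Fin k → A))) :=
    fun n => (Submodule.liftQ _ (S n).1 (hker n)).comp (AdicCompletion.eval J W n)
  have hfsucc : ∀ {n : ℕ}, Submodule.factorPow J (Fin k → A) (n.le_succ) ∘ₗ f (n + 1) = f n := by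
    intro n
    refine LinearMap.ext fun x => ?_
    obtain ⟨w, hw⟩ := Submodule.Quotient.mk_surjective _ (x.val (n + 1))
    have hw' : x.val n = Submodule.Quotient.mk w := by
      rw [← AdicCompletion.transitionMap_comp_eval_apply J W n.le_succ, ← hw]
      rfl
    change Submodule.factorPow J (Fin k → A) n.le_succ
      (Submodule.liftQ _ (S (n + 1)).1 (hker (n + 1)) (x.val (n + 1))) =
      Submodule.liftQ _ (S n).1 (hker n) (x.val n)
    rw [← hw, hw']
    exact hS n w
  have hf : ∀ {m n : ℕ} (hle : m ≤ n), Submodule.factorPow J (Fin k → A) hle ∘ₗ f n = f m :=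
    fun hle => IsAdicComplete.StrictMono.factorPow_comp_eq_of_factorPow_comp_succ_eq
      strictMono_id f hfsucc hle
  refine Module.Projective.of_split (IsAdicComplete.lift J f hf) π ?_
  refine LinearMap.ext fun x => ?_
  refine AdicCompletion.ext fun n => ?_
  rw [LinearMap.comp_apply, ← hqmk, IsAdicComplete.mk_lift]
  obtain ⟨w, hw⟩ := Submodule.Quotient.mk_surjective _ (x.val n)
  change q n (Submodule.liftQ _ (S n).1 (hker n) (x.val n)) = x.val n
  rw [← hw]
  exact (S n).2 w

/-- Let `B → A` be a continuous homomorphism of preadic rings with ideal of definition `J ⊆ A`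
(and `K ⊆ B`, with `K·A ⊆ J`), such that `A` is a formally smooth `B`-algebra. Then
`Ω¹_{A/B} ⊗_A A/J` is a projective `A/J`-module; moreover, if `A` is a `J`-adically complete
noetherian ring and the completed module of differentials `Ω̂¹_{A/B}` is a finitely generated
`A`-module, then `Ω̂¹_{A/B}` is a projective `A`-module. -/
theorem projective_differentials_of_isFormallySmoothPreadic {B : Type uB} {A : Type uA}
    [CommRing B] [CommRing A] [Algebra B A] (K : Ideal B) (J : Ideal A)
    (hcont : K.map (algebraMap B A) ≤ J)
    (hsm : IsFormallySmoothPreadic.{uB, uA, uA} (algebraMap B A) K J) :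
    Module.Projective (A ⧸ J) (TensorProduct A (A ⧸ J) (KaehlerDifferential B A)) ∧
    (IsNoetherianRing A → IsAdicComplete J A →
      Module.Finite A (AdicCompletion J (KaehlerDifferential B A)) →
      Module.Projective A (AdicCompletion J (KaehlerDifferential B A))) := by
  refine ⟨?_, fun _ _ _ => projective_adicCompletion_of_lift J
    fun n M N _ _ _ _ hM p g hg =>
      kaehler_lift_of_isFormallySmoothPreadic K J hcont hsm n hM p g hg⟩
  refine .of_lifting_property'' fun f hf => ?_
  obtain ⟨h, hh⟩ := kaehler_lift_of_isFormallySmoothPreadic K J hcont hsm 1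
    (M := TensorProduct A (A ⧸ J) (KaehlerDifferential B A) →₀ (A ⧸ J))
    (by
      intro a ha m
      rw [pow_one] at ha
      rw [← algebraMap_smul (A ⧸ J) a m, Ideal.Quotient.algebraMap_eq,
        Ideal.Quotient.eq_zero_iff_mem.2 ha, zero_smul])
    (f.restrictScalars A) (TensorProduct.mk A (A ⧸ J) (KaehlerDifferential B A) 1)
    (fun x => hf _)
  refine ⟨h.liftBaseChange (A ⧸ J), ?_⟩
  refine TensorProduct.AlgebraTensorModule.curry_injective ?_
  ext x
  simpa using hh (KaehlerDifferential.D B A x)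
end
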